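/- The set Γ_H^ord = {y ∈ [0, 2/3] : dim_H(L(y)) > 0} of ordinates whose Takagi level set has positive Hausdorff dimension has full Hausdorff dimension: dim_H(Γ_H^ord) = 1. -/

import Mathlib

open MeasureTheory Set

/-- Distance from a real number to the nearest integer. -/
noncomputable def distNearestInt (t : ℝ) : ℝ := |t - round t|

/-- The Takagi function. -/
noncomputable def takagi (x : ℝ) : ℝ := ∑' n : ℕ, distNearestInt (2 ^ n * x) / 2 ^ n

/-- The `j`-th binary digit of `x ∈ [0,1)` (binary expansion terminating in `0^∞`). -/
noncomputable def bdigit (x : ℝ) (j : ℕ) : ℤ := ⌊(2 : ℝ) ^ j * x⌋ - 2 * ⌊(2 : ℝ) ^ (j - 1) * x⌋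

/-- The deficient digit function `D_j(x) = j - 2(b_1(x) + ⋯ + b_j(x))`. -/
noncomputable def defDigit (x : ℝ) (j : ℕ) : ℤ := (j : ℤ) - 2 * ∑ i ∈ Finset.Icc 1 j, bdigit x i

/-- The deficient digit set `Ω^L`. -/
noncomputable def OmegaL : Set ℝ := {x | x ∈ Set.Ico (0 : ℝ) 1 ∧ ∀ j : ℕ, 1 ≤ j → 0 ≤ defDigit x j}

/-- The set `½Ω^L = {x ∈ [0,1) : D_j(x) > 0 for all j ≥ 1}`. -/
noncomputable def halfOmegaL : Set ℝ :=
  {x | x ∈ Set.Ico (0 : ℝ) 1 ∧ ∀ j : ℕ, 1 ≤ j → 0 < defDigit x j}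

/-- The Takagi singular function. -/
noncomputable def takagiS (x : ℝ) : ℝ := sSup {y | ∃ t ∈ OmegaL, t ≤ x ∧ y = takagi t + t}

/-- `Ω^L_∞`: points of `Ω^L` with infinitely many balance points. -/
noncomputable def OmegaLinf : Set ℝ :=
  {x ∈ OmegaL | {j : ℕ | 1 ≤ j ∧ defDigit x j = 0}.Infinite}

/-- `Ω^L_fin = Ω^L \ Ω^L_∞`. -/
noncomputable def OmegaLfin : Set ℝ := OmegaL \ OmegaLinf

/-- `(m, k)` encodes a member `k / 2^(2m)` of the breakpoint set `ℬ'`. -/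
noncomputable def breakpoint (m k : ℕ) : Prop :=
  (m = 0 ∧ k = 0) ∨
    (1 ≤ m ∧ 0 < k ∧ k < 2 ^ (2 * m) ∧
      (∀ j : ℕ, 1 ≤ j → j ≤ 2 * m - 1 → 0 ≤ defDigit ((k : ℝ) / 2 ^ (2 * m)) j) ∧
      defDigit ((k : ℝ) / 2 ^ (2 * m)) (2 * m) = 0)

/-- The fine partition set `Ω^L(B)` for `B = k / 2^(2m)`. -/
noncomputable def fineSet (m k : ℕ) : Set ℝ :=
  {x | ∃ x' ∈ halfOmegaL, x = (k : ℝ) / 2 ^ (2 * m) + x' / 2 ^ (2 * m)}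

/-- The set `Γ_{2r}`. -/
noncomputable def Gamma (r : ℕ) : Set ℝ :=
  {x | x ∈ Set.Ico (0 : ℝ) 1 ∧ ∀ j : ℕ, 1 ≤ j →
    ((¬ (2 * r ∣ j) → 0 < defDigit x j) ∧ ((2 * r) ∣ j → defDigit x j = 0))}

/-- The level set `L(y)` of the Takagi function. -/
noncomputable def levelSet (y : ℝ) : Set ℝ := {x ∈ Set.Icc (0 : ℝ) 1 | takagi x = y}
open scoped NNReal ENNReal

theorem sep_ofDigits {b : ℕ} {x y : ℕ → Fin b} {n : ℕ}
    (hxy : ∀ i < n, x i = y i) (hn : (2:ℤ) ≤ |((x n : ℕ) : ℤ) - ((y n : ℕ) : ℤ)|) :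
    ((b : ℝ) ^ (n+1))⁻¹ ≤ |Real.ofDigits x - Real.ofDigits y| := by
  rw [Real.ofDigits_eq_sum_add_ofDigits x (n+1), Real.ofDigits_eq_sum_add_ofDigits y (n+1)]
  have : ∑ i ∈ Finset.range n, Real.ofDigitsTerm x i
      = ∑ i ∈ Finset.range n, Real.ofDigitsTerm y i :=
    Finset.sum_congr rfl fun i hi ↦ by
      simp [Real.ofDigitsTerm, hxy i (Finset.mem_range.mp hi)]
  rw [Finset.sum_range_succ, Finset.sum_range_succ, this]
  have h1 := Real.ofDigits_nonneg (fun i ↦ x (i + (n+1)))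
  have h2 := Real.ofDigits_le_one (fun i ↦ x (i + (n+1)))
  have h3 := Real.ofDigits_nonneg (fun i ↦ y (i + (n+1)))
  have h4 := Real.ofDigits_le_one (fun i ↦ y (i + (n+1)))
  have hb : 0 ≤ ((b : ℝ) ^ (n+1))⁻¹ := by positivity
  have hn' : (2:ℝ) ≤ |((x n : ℕ) : ℝ) - ((y n : ℕ) : ℝ)| := by exact_mod_cast hn
  have ex : Real.ofDigitsTerm x n = (x n : ℕ) * ((b : ℝ) ^ (n+1))⁻¹ := rfl
  have ey : Real.ofDigitsTerm y n = (y n : ℕ) * ((b : ℝ) ^ (n+1))⁻¹ := rfl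
  rw [ex, ey]
  set B := ((b : ℝ) ^ (n+1))⁻¹
  set u := Real.ofDigits (fun i ↦ x (i + (n+1)))
  set v := Real.ofDigits (fun i ↦ y (i + (n+1)))
  set S := ∑ i ∈ Finset.range n, Real.ofDigitsTerm y i
  have e : S + (x n : ℕ) * B + B * u - (S + (y n : ℕ) * B + B * v)
     = B * ((((x n : ℕ) : ℝ) - ((y n : ℕ) : ℝ)) + (u - v)) := by ring
  rw [e, abs_mul, abs_of_nonneg hb]
  have : 1 ≤ |(((x n : ℕ) : ℝ) - ((y n : ℕ) : ℝ)) + (u - v)| := by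
    rcases le_abs.1 hn' with h | h
    · exact le_abs.2 (Or.inl (by linarith))
    · exact le_abs.2 (Or.inr (by linarith))
  nlinarith

theorem dim_lower {b N : ℕ} (hb : 1 < b) (hN : 1 < N) (e : ℕ → Fin N → Fin b)
    (he : ∀ i p q, p ≠ q → (2:ℤ) ≤ |((e i p : ℕ) : ℤ) - ((e i q : ℕ) : ℤ)|)
    (s : ℝ≥0) (hs : 0 < s) (hsN : (b:ℝ) ^ (s:ℝ) ≤ N) :
    (s : ℝ≥0∞) ≤ dimH (Set.range fun c : ℕ → Fin N => Real.ofDigits (fun i => e i (c i))) := by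
  have hN0 : (0:ℝ) < N := by positivity
  have hb0 : (0:ℝ) < b := by positivity
  set X : (ℕ → Fin N) → ℝ := fun c => Real.ofDigits (fun i => e i (c i)) with hX
  have : NeZero N := ⟨by omega⟩
  have key : ∀ c c' : ℕ → Fin N,
      |Real.ofDigits c - Real.ofDigits c'| ≤ N * |X c - X c'| ^ (s:ℝ) := by
    intro c c'
    by_cases hcc : c = c'
    · subst hcc
      simp only [sub_self, abs_zero]
      positivity
    · have hex : ∃ n, c n ≠ c' n := Function.ne_iff.1 hcc
      classical
      set n := Nat.find hex
      have hn : c n ≠ c' n := Nat.find_spec hex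
      have hlt : ∀ i < n, c i = c' i := fun i hi => not_not.1 (Nat.find_min hex hi)
      have h1 := Real.abs_ofDigits_sub_ofDigits_le hlt
      have h2 : ((b : ℝ) ^ (n+1))⁻¹ ≤ |X c - X c'| :=
        sep_ofDigits (x := fun i => e i (c i)) (y := fun i => e i (c' i))
          (fun i hi => by simp [hlt i hi]) (he n _ _ hn)
      calc _ ≤ _ := h1
        _ = N * ((N:ℝ) ^ (n+1))⁻¹ := by field_simp; ring
        _ ≤ N * (((b:ℝ) ^ (s:ℝ)) ^ (n+1))⁻¹ := by gcongr
        _ = N * (((b:ℝ) ^ (n+1))⁻¹) ^ (s:ℝ) := by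
          rw [Real.inv_rpow (by positivity), ← Real.rpow_natCast, ← Real.rpow_mul hb0.le,
            ← Real.rpow_natCast, ← Real.rpow_mul hb0.le, mul_comm (s:ℝ)]
        _ ≤ _ := by gcongr
  set g : ℝ → ℝ := fun x => Real.ofDigits (Function.invFun X x) with hg
  have hinv : ∀ x ∈ Set.range X, X (Function.invFun X x) = x := fun x hx => Function.invFun_eq hx
  have hXY : ∀ c, g (X c) = Real.ofDigits c := by
    intro c
    have := key (Function.invFun X (X c)) c
    rw [hinv _ ⟨c, rfl⟩, sub_self, abs_zero, Real.zero_rpow (by positivity), mul_zero] at this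
    exact sub_eq_zero.1 (abs_nonpos_iff.1 this)
  have hH : HolderOnWith (N : ℝ≥0) s g (Set.range X) := by
    rintro _ ⟨c, rfl⟩ _ ⟨c', rfl⟩
    rw [hXY, hXY, edist_dist, edist_dist, Real.dist_eq, Real.dist_eq,
      ENNReal.ofReal_rpow_of_nonneg (abs_nonneg _) s.coe_nonneg]
    have : ((N:ℝ≥0) : ℝ≥0∞) = ENNReal.ofReal (N:ℝ) := by simp
    rw [this, ← ENNReal.ofReal_mul (by positivity)]
    exact ENNReal.ofReal_le_ofReal (key c c')
  have h1 := hH.dimH_image_le hs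
  have h2 : Set.Icc (0:ℝ) 1 ⊆ g '' Set.range X := by
    intro y hy
    obtain ⟨c, -, hc⟩ := Real.ofDigits_SurjOn hN hy
    exact ⟨X c, ⟨c, rfl⟩, by rw [hXY, hc]⟩
  have h3 : dimH (Set.Icc (0:ℝ) 1) = 1 := by
    rw [Real.dimH_of_nonempty_interior]
    · simp
    · simp
  have h4 : 1 ≤ dimH (Set.range X) / s := h3 ▸ (dimH_mono h2).trans h1
  rw [ENNReal.le_div_iff_mul_le (Or.inl (by simpa using hs.ne')) (Or.inl (by simp))] at h4
  simpa using h4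

theorem dni_nonneg (t : ℝ) : 0 ≤ distNearestInt t := abs_nonneg _
theorem dni_le (t : ℝ) : distNearestInt t ≤ 1/2 := abs_sub_round t
theorem dni_le_int (t : ℝ) (k : ℤ) : distNearestInt t ≤ |t - k| := round_le t k
theorem dni_add_int (t : ℝ) (k : ℤ) : distNearestInt (t + k) = distNearestInt t := by
  unfold distNearestInt
  rw [round_add_intCast]; push_cast; congr 1; ring
theorem dni_left {t : ℝ} (h0 : 0 ≤ t) (h1 : t ≤ 1/2) : distNearestInt t = t := by
  apply le_antisymm
  · have := dni_le_int t 0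
    simpa [abs_of_nonneg h0] using this
  · unfold distNearestInt
    rcases le_or_gt (round t) 0 with h | h
    · have : ((round t : ℤ) : ℝ) ≤ 0 := by exact_mod_cast h
      exact le_abs.2 (Or.inl (by linarith))
    · have : (1:ℝ) ≤ (round t : ℤ) := by exact_mod_cast h
      exact le_abs.2 (Or.inr (by linarith))
theorem dni_right {t : ℝ} (h0 : 1/2 ≤ t) (h1 : t ≤ 1) : distNearestInt t = 1 - t := by
  apply le_antisymm
  · have := dni_le_int t 1
    rw [abs_of_nonpos (by push_cast; linarith)] at this
    push_cast at this; linarith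
  · unfold distNearestInt
    rcases le_or_gt (round t) 0 with h | h
    · have : ((round t : ℤ) : ℝ) ≤ 0 := by exact_mod_cast h
      exact le_abs.2 (Or.inl (by linarith))
    · have : (1:ℝ) ≤ (round t : ℤ) := by exact_mod_cast h
      exact le_abs.2 (Or.inr (by linarith))
theorem dni_two (t : ℝ) : distNearestInt t + distNearestInt (2 * t) / 2 ≤ 1/2 := by
  have h : distNearestInt t = |t - round t| := rfl
  have h' := dni_le t
  rcases le_total 0 (t - round t) with h0 | h0
  · rw [abs_of_nonneg h0] at h
    have := dni_le_int (2*t) (2 * round t + 1)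
    rw [abs_of_nonpos (by push_cast; linarith)] at this
    push_cast at this; linarith
  · rw [abs_of_nonpos h0] at h
    have := dni_le_int (2*t) (2 * round t - 1)
    rw [abs_of_nonneg (by push_cast; linarith)] at this
    push_cast at this; linarith

theorem tak_term_le (x : ℝ) (n : ℕ) : distNearestInt (2 ^ n * x) / 2 ^ n ≤ (1/2 : ℝ) ^ n := by
  rw [one_div, inv_pow, div_eq_mul_inv]
  have := dni_le (2 ^ n * x)
  have h2 : (0:ℝ) ≤ (2^n)⁻¹ := by positivity
  nlinarith

theorem tak_summable (x : ℝ) : Summable fun n : ℕ => distNearestInt (2 ^ n * x) / 2 ^ n :=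
  Summable.of_nonneg_of_le (fun n => div_nonneg (dni_nonneg _) (by positivity))
    (tak_term_le x) (summable_geometric_of_lt_one (by norm_num) (by norm_num))

theorem tak_nonneg (x : ℝ) : 0 ≤ takagi x :=
  tsum_nonneg fun n => div_nonneg (dni_nonneg _) (by positivity)

theorem tak_le_two (x : ℝ) : takagi x ≤ 2 := by
  have := Summable.tsum_mono (tak_summable x)
    (summable_geometric_of_lt_one (r := (1/2:ℝ)) (by norm_num) (by norm_num)) (tak_term_le x)
  rwa [tsum_geometric_two] at this

theorem tak_rec (x : ℝ) : takagi x = distNearestInt x + takagi (2 * x) / 2 := by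
  unfold takagi
  rw [(tak_summable x).tsum_eq_zero_add, ← tsum_div_const]
  simp only [pow_zero, one_mul, div_one]
  congr 1
  apply tsum_congr
  intro n
  rw [show (2:ℝ) ^ (n+1) * x = 2 ^ n * (2 * x) by ring, pow_succ, div_div]

theorem tak_add_one (x : ℝ) : takagi (1 + x) = takagi x := by
  unfold takagi
  apply tsum_congr
  intro n
  have : (2:ℝ) ^ n * (1 + x) = 2 ^ n * x + ((2 ^ n : ℤ) : ℝ) := by push_cast; ring
  rw [this, dni_add_int]

theorem tak_le (x : ℝ) : takagi x ≤ 2/3 := by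
  have h : ∀ n : ℕ, ∀ x, takagi x ≤ 2/3 + 2 * (1/4:ℝ) ^ n := by
    intro n
    induction n with
    | zero => intro x; have := tak_le_two x; norm_num; linarith
    | succ n ih =>
      intro x
      have h1 := tak_rec x
      have h2 := tak_rec (2 * x)
      have h3 := ih (2 * (2 * x))
      have h4 := dni_two x
      rw [pow_succ]
      linarith
  have ht : Filter.Tendsto (fun n : ℕ => 2/3 + 2 * (1/4:ℝ) ^ n) Filter.atTop (nhds (2/3 + 2 * 0)) :=
    (tendsto_const_nhds).add ((tendsto_pow_atTop_nhds_zero_of_lt_one (by norm_num)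
      (by norm_num)).const_mul 2)
  have := ge_of_tendsto' ht (fun n => h n x)
  linarith

theorem tak_zero : takagi 0 = 0 := by
  have := tak_rec 0
  rw [mul_zero, dni_left le_rfl (by norm_num)] at this
  linarith

theorem tak_left {z : ℝ} (h0 : 0 ≤ z) (h1 : z ≤ 1) : takagi (z/2) = (z + takagi z)/2 := by
  rw [tak_rec, dni_left (by linarith) (by linarith), show 2 * (z/2) = z by ring]; ring

theorem tak_right {z : ℝ} (h0 : 0 ≤ z) (h1 : z ≤ 1) :
    takagi ((1+z)/2) = (1 - z + takagi z)/2 := by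
  rw [tak_rec, dni_right (by linarith) (by linarith), show 2 * ((1+z)/2) = 1 + z by ring,
    tak_add_one]; ring

/-- integer value of a binary word -/
def wN : List Bool → ℤ
  | [] => 0
  | b :: w => (if b then 2 ^ w.length else 0) + wN w
/-- scaled Takagi value of a binary word -/
def wT : List Bool → ℤ
  | [] => 0
  | b :: w => (if b then 2 ^ w.length - wN w else wN w) + wT w
/-- digit deficiency -/
def wD : List Bool → ℤ
  | [] => 0
  | b :: w => (if b then -1 else 1) + wD w

theorem wN_nonneg (w : List Bool) : 0 ≤ wN w := by
  induction w with
  | nil => simp [wN]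
  | cons b w ih => cases b <;> simp [wN, ih]; positivity
theorem wN_lt (w : List Bool) : wN w < 2 ^ w.length := by
  induction w with
  | nil => simp [wN]
  | cons b w ih =>
    have : (0:ℤ) < 2 ^ w.length := by positivity
    cases b <;> simp [wN, pow_succ] <;> linarith

theorem tak_word (w : List Bool) : ∀ x : ℝ, 0 ≤ x → x ≤ 1 →
    takagi ((wN w + x) / 2 ^ w.length) = (wT w + wD w * x + takagi x) / 2 ^ w.length := by
  induction w with
  | nil => intro x _ _; simp [wN, wT, wD]
  | cons b w ih =>
    intro x h0 h1
    have hp : (0:ℝ) < 2 ^ w.length := by positivity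
    have hn : (0:ℝ) ≤ wN w := by exact_mod_cast wN_nonneg w
    have hl : (wN w : ℝ) + 1 ≤ 2 ^ w.length := by exact_mod_cast wN_lt w
    have z0 : 0 ≤ (wN w + x) / 2 ^ w.length := by positivity
    have z1 : (wN w + x) / 2 ^ w.length ≤ 1 := by rw [div_le_one hp]; linarith
    have I := ih x h0 h1
    cases b
    · have := tak_left z0 z1
      rw [I] at this
      have e : ((wN (false :: w) : ℤ) + x) / 2 ^ (false :: w).length
        = (wN w + x) / 2 ^ w.length / 2 := by
        simp [wN, pow_succ]; field_simp
      rw [e, this]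
      simp [wT, wD, pow_succ]; field_simp; ring
    · have := tak_right z0 z1
      rw [I] at this
      have e : ((wN (true :: w) : ℤ) + x) / 2 ^ (true :: w).length
        = (1 + (wN w + x) / 2 ^ w.length) / 2 := by
        simp [wN, pow_succ]; field_simp; ring
      rw [e, this]
      simp [wT, wD, pow_succ]; field_simp; ring

theorem wT_eq (w : List Bool) : (wT w : ℝ) = 2 ^ w.length * takagi (wN w / 2 ^ w.length) := by
  have := tak_word w 0 le_rfl zero_le_one
  rw [tak_zero, add_zero] at this
  rw [this]; field_simp; ring
theorem wT_nonneg (w : List Bool) : 0 ≤ wT w := by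
  have : (0:ℝ) ≤ wT w := by rw [wT_eq]; exact mul_nonneg (by positivity) (tak_nonneg _)
  exact_mod_cast this
theorem wT_lt (w : List Bool) : wT w < 2 ^ w.length := by
  have : (wT w : ℝ) < 2 ^ w.length := by
    rw [wT_eq]
    have h := tak_le (wN w / 2 ^ w.length)
    have : (0:ℝ) < 2 ^ w.length := by positivity
    nlinarith
  exact_mod_cast this

theorem wN_append (u v : List Bool) : wN (u ++ v) = wN u * 2 ^ v.length + wN v := by
  induction u with
  | nil => simp [wN]
  | cons b u ih => cases b <;> simp [wN, ih, pow_add] <;> ring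
theorem wD_append (u v : List Bool) : wD (u ++ v) = wD u + wD v := by
  induction u with
  | nil => simp [wD]
  | cons b u ih => cases b <;> simp [wD, ih] <;> ring
theorem wT_append (u v : List Bool) :
    wT (u ++ v) = wT u * 2 ^ v.length + wD u * wN v + wT v := by
  induction u with
  | nil => simp [wT, wD]
  | cons b u ih => cases b <;> simp [wT, wD, ih, pow_add, wN_append] <;> ring

theorem wN_compl (w : List Bool) : wN (w.map not) = 2 ^ w.length - 1 - wN w := by
  induction w with
  | nil => simp [wN]
  | cons b u ih => cases b <;> simp [wN, ih, pow_succ] <;> ring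
theorem wD_compl (w : List Bool) : wD (w.map not) = - wD w := by
  induction w with
  | nil => simp [wD]
  | cons b u ih => cases b <;> simp [wD, ih] <;> ring
theorem wT_compl (w : List Bool) : wT (w.map not) = wT w + wD w := by
  induction w with
  | nil => simp [wT, wD]
  | cons b u ih => cases b <;> simp [wT, wD, ih, wN_compl] <;> ring

theorem wN_inj (u : List Bool) : ∀ v : List Bool, u.length = v.length → wN u = wN v → u = v := by
  induction u with
  | nil => intro v h _; simpa using h.symm
  | cons b u ih =>
    intro v hl hN
    match v with
    | [] => simp at hl
    | b' :: v =>
      have hl' : u.length = v.length := by simpa using hl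
      have a1 := wN_lt u
      have a2 := wN_lt v
      have a3 := wN_nonneg u
      have a4 := wN_nonneg v
      rw [← hl'] at a2
      cases b <;> cases b' <;> simp [wN, ← hl'] at hN ⊢
      · exact ih v hl' hN
      · linarith
      · linarith
      · exact ih v hl' hN

theorem wD_eq (w : List Bool) : wD w = w.length - 2 * (w.count true : ℕ) := by
  induction w with
  | nil => simp [wD]
  | cons b u ih => cases b <;> simp [wD, ih] <;> ring

theorem wN_pos (w : List Bool) (h : 0 < w.count true) : 1 ≤ wN w := by
  induction w with
  | nil => simp at h
  | cons b u ih =>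
    cases b
    · simp at h
      simpa [wN] using ih (List.count_pos_iff.2 h)
    · have := wN_nonneg u
      have h2 : (0:ℤ) < 2 ^ u.length := by positivity
      simp [wN]; linarith

theorem exists_words : ∀ n k : ℕ, ∃ S : Finset (List Bool), S.card = n.choose k ∧
    ∀ w ∈ S, w.length = n ∧ w.count true = k := by
  intro n
  induction n with
  | zero =>
    intro k
    cases k with
    | zero => exact ⟨{[]}, by simp⟩
    | succ k => exact ⟨∅, by simp⟩
  | succ n ih =>
    intro k
    obtain ⟨S, hS, hS'⟩ := ih k
    cases k with
    | zero =>
      refine ⟨S.image (List.cons false), ?_, ?_⟩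
      · rw [Finset.card_image_of_injective _ List.cons_injective, hS]; simp
      · intro w hw
        obtain ⟨v, hv, rfl⟩ := Finset.mem_image.1 hw
        have := hS' v hv
        simp only [List.length_cons, List.count_cons]
        simp [this.1, this.2]
    | succ k =>
      obtain ⟨R, hR, hR'⟩ := ih k
      refine ⟨R.image (List.cons true) ∪ S.image (List.cons false), ?_, ?_⟩
      · rw [Finset.card_union_of_disjoint, Finset.card_image_of_injective _ List.cons_injective,
          Finset.card_image_of_injective _ List.cons_injective, hS, hR, Nat.choose_succ_succ]
        rw [Finset.disjoint_left]
        intro w h1 h2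
        obtain ⟨v, hv, rfl⟩ := Finset.mem_image.1 h1
        obtain ⟨v', hv', h⟩ := Finset.mem_image.1 h2
        simp at h
      · intro w hw
        rcases Finset.mem_union.1 hw with hw | hw
        · obtain ⟨v, hv, rfl⟩ := Finset.mem_image.1 hw
          have := hR' v hv
          simp only [List.length_cons, List.count_cons]
          simp [this.1, this.2]
        · obtain ⟨v, hv, rfl⟩ := Finset.mem_image.1 hw
          have := hS' v hv
          simp only [List.length_cons, List.count_cons]
          simp [this.1, this.2]

/-- slope-weighted value -/
def wG (K : ℤ) (w : List Bool) : ℤ := K * wN w + wT w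

theorem wG_append (K : ℤ) (u v : List Bool) (h : wD u = 0) :
    wG K (u ++ v) = wG K u * 2 ^ v.length + wG K v := by
  simp only [wG, wN_append, wT_append, h]; ring

theorem exists_concat (m : ℕ) (hm : 0 < m) (B K : ℤ) (hB : B = 2 ^ (2*m)) (hK : K = B^2 + 1)
    (q : ℕ) : ∃ S : Finset (List Bool), S.card = (Nat.centralBinom m) ^ q ∧
    (∀ w ∈ S, w.length = 2*m*q ∧ wD w = 0) ∧
    ∀ w ∈ S, ∀ w' ∈ S, (B-1) * |wG K w - wG K w'| ≤ (K*(B-2)+B) * (B^q - 1) ∧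
      (w ≠ w' → wG K w ≠ wG K w') := by
  obtain ⟨U, hU, hU'⟩ := exists_words (2*m) m
  have hB2 : 2 ≤ B := by
    rw [hB]
    calc (2:ℤ) = 2^1 := by norm_num
      _ ≤ 2^(2*m) := pow_le_pow_right₀ (by norm_num) (by omega)
  have hKB : B ≤ K := by nlinarith
  have hbase : ∀ u ∈ U, ∀ u' ∈ U, |wG K u - wG K u'| ≤ K*(B-2)+B ∧
      (u ≠ u' → K - B ≤ |wG K u - wG K u'|) := by
    intro u hu u' hu'
    obtain ⟨l, c⟩ := hU' u hu
    obtain ⟨l', c'⟩ := hU' u' hu'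
    have n1 := wN_lt u
    have n2 := wN_lt u'
    have n3 := wN_pos u (by omega)
    have n4 := wN_pos u' (by omega)
    have t1 := wT_lt u
    have t2 := wT_lt u'
    have t3 := wT_nonneg u
    have t4 := wT_nonneg u'
    rw [l, ← hB] at n1 t1
    rw [l', ← hB] at n2 t2
    constructor
    · rw [abs_le]; unfold wG; constructor <;> nlinarith
    · intro hne
      have : wN u ≠ wN u' := fun h => hne (wN_inj u u' (by omega) h)
      unfold wG
      rcases lt_or_gt_of_ne this with h | h
      · refine le_abs.2 (Or.inr ?_)
        nlinarith
      · refine le_abs.2 (Or.inl ?_)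
        nlinarith
  have hUD : ∀ u ∈ U, wD u = 0 := by
    intro u hu
    obtain ⟨l, c⟩ := hU' u hu
    rw [wD_eq, l, c]; push_cast; ring
  induction q with
  | zero => exact ⟨{[]}, by simp, by simp [wD], by simp⟩
  | succ q ih =>
    obtain ⟨S, hS, hS1, hS2⟩ := ih
    refine ⟨(U ×ˢ S).image (fun p => p.1 ++ p.2), ?_, ?_, ?_⟩
    · rw [Finset.card_image_of_injOn, Finset.card_product, hU, hS, pow_succ, mul_comm,
        Nat.centralBinom]
      rintro ⟨u, v⟩ h ⟨u', v'⟩ h' he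
      simp only [Finset.coe_product, Set.mem_prod, Finset.mem_coe] at h h'
      have := List.append_inj he (by rw [(hU' u h.1).1, (hU' u' h'.1).1])
      exact Prod.ext this.1 this.2
    · intro w hw
      obtain ⟨⟨u, v⟩, h, rfl⟩ := Finset.mem_image.1 hw
      obtain ⟨h1, h2⟩ := Finset.mem_product.1 h
      constructor
      · simp only [List.length_append]
        rw [(hU' u h1).1, (hS1 v h2).1]; ring
      · rw [wD_append, hUD u h1, (hS1 v h2).2]; rfl
    · intro w hw w' hw'
      obtain ⟨⟨u, v⟩, h, rfl⟩ := Finset.mem_image.1 hw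
      obtain ⟨h1, h2⟩ := Finset.mem_product.1 h
      obtain ⟨⟨u', v'⟩, h', rfl⟩ := Finset.mem_image.1 hw'
      obtain ⟨h1', h2'⟩ := Finset.mem_product.1 h'
      dsimp only at h1 h2 h1' h2' ⊢
      have hBq : (2:ℤ) ^ (2*m*q) = B ^ q := by rw [hB, ← pow_mul]
      rw [wG_append K u v (hUD u h1), wG_append K u' v' (hUD u' h1'), (hS1 v h2).1,
        (hS1 v' h2').1, hBq]
      obtain ⟨b1, b2⟩ := hbase u h1 u' h1'
      obtain ⟨s1, s2⟩ := hS2 v h2 v' h2'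
      have hBp : 0 < B ^ q := by positivity
      have e : wG K u * B ^ q + wG K v - (wG K u' * B ^ q + wG K v')
        = (wG K u - wG K u') * B ^ q + (wG K v - wG K v') := by ring
      constructor
      · rw [e]
        have h3 := abs_add_le ((wG K u - wG K u') * B ^ q) (wG K v - wG K v')
        rw [abs_mul, abs_of_pos hBp] at h3
        have h4 : (B-1) * (|wG K u - wG K u'| * B^q) ≤ (B-1) * ((K*(B-2)+B) * B^q) := by
          gcongr; linarith
        have h5 := mul_le_mul_of_nonneg_left h3 (show 0 ≤ B - 1 by linarith)
        rw [pow_succ]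
        linarith
      · intro hne heq
        by_cases huu : u = u'
        · subst huu
          have hv : v ≠ v' := by rintro rfl; exact hne rfl
          exact s2 hv (by linarith)
        · have b3 := b2 huu
          have h3 : (wG K u - wG K u') * B ^ q = -(wG K v - wG K v') := by linarith
          have h4 := congrArg abs h3
          rw [abs_mul, abs_neg, abs_of_pos hBp] at h4
          rw [← h4] at s1
          have h5 : (B-1) * ((K-B) * B^q) ≤ (B-1) * (|wG K u - wG K u'| * B^q) := by
            gcongr; linarith
          have h6 : (B-1) * ((K-B) * B^q) = (K*(B-2)+B) * B^q + B^q := by rw [hK]; ring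
          have h7 : 0 ≤ K*(B-2)+B := by nlinarith
          linarith

theorem rep_false (K : ℕ) : wN (List.replicate K false) = 0 ∧ wT (List.replicate K false) = 0 ∧
    wD (List.replicate K false) = K := by
  induction K with
  | zero => simp [wN, wT, wD]
  | succ n ih => simp [List.replicate_succ, wN, wT, wD, ih, add_comm]

theorem rep_true (K : ℕ) : wD (List.replicate K true) = -K := by
  induction K with
  | zero => simp [wD]
  | succ n ih => simp [List.replicate_succ, wD, ih]

theorem numeric (s : ℝ) (hs : 0 < s) (hs1 : s < 1) : ∃ m : ℕ, 0 < m ∧ ∀ K : ℕ, ∃ q : ℕ, 0 < q ∧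
    (((2 ^ (2*K + 2*m*q) : ℕ) : ℝ)) ^ s ≤ ((Nat.centralBinom m ^ q : ℕ) : ℝ) := by
  have ha : (1:ℝ) < 4 ^ (1 - s) := Real.one_lt_rpow (by norm_num) (by linarith)
  have ht := tendsto_pow_const_div_const_pow_of_one_lt 1 ha
  have hev := (ht.eventually (gt_mem_nhds (show (0:ℝ) < 1/2 by norm_num))).and
    (Filter.eventually_gt_atTop 0)
  obtain ⟨m, hm, hm0⟩ := hev.exists
  refine ⟨m, hm0, fun K => ?_⟩
  rw [pow_one, div_lt_iff₀ (by positivity)] at hm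
  have hc : (4:ℝ) ^ m ≤ 2 * m * Nat.centralBinom m := by
    exact_mod_cast Nat.four_pow_le_two_mul_self_mul_centralBinom m hm0
  have hm' : (0:ℝ) < m := by exact_mod_cast hm0
  set C : ℝ := (Nat.centralBinom m : ℝ) with hC
  have hCpos : 0 < C := by rw [hC]; exact_mod_cast Nat.centralBinom_pos m
  set A : ℝ := (4 ^ s) ^ m with hA
  have hApos : 0 < A := by positivity
  have hAA : (4:ℝ) ^ m = A * (4 ^ (1-s)) ^ m := by
    rw [hA, ← mul_pow, ← Real.rpow_add (by norm_num)]; simp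
  have hAC : A < C := by
    have hx : 0 < ((4:ℝ) ^ (1-s)) ^ m := by positivity
    have h1 : 2 * m * C < ((4:ℝ) ^ (1-s)) ^ m * C := by gcongr; linarith
    rw [hAA] at hc
    have h2 : ((4:ℝ) ^ (1-s)) ^ m * A < ((4:ℝ) ^ (1-s)) ^ m * C := by linarith
    exact lt_of_mul_lt_mul_left h2 hx.le
  have hr : 1 < C / A := by rwa [one_lt_div hApos]
  obtain ⟨q, hq⟩ := pow_unbounded_of_one_lt ((4 ^ s) ^ K : ℝ) hr
  have h1 : (1:ℝ) ≤ 4 ^ s := Real.one_le_rpow (by norm_num) hs.le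
  refine ⟨q, ?_, ?_⟩
  · rcases Nat.eq_zero_or_pos q with h | h
    · subst h
      have := one_le_pow₀ h1 (n := K)
      simp at hq; linarith
    · exact h
  · have e : ((2 ^ (2*K + 2*m*q) : ℕ) : ℝ) = 4 ^ (K + m*q) := by
      push_cast
      rw [show 2*K + 2*m*q = 2 * (K + m*q) by ring, pow_mul]; norm_num
    rw [e, ← Real.rpow_natCast, ← Real.rpow_mul (by norm_num), mul_comm, Real.rpow_mul (by norm_num),
      Real.rpow_natCast, pow_add, pow_mul, ← hA]
    push_cast
    rw [← hC]
    rw [div_pow, lt_div_iff₀ (by positivity)] at hq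
    exact hq.le

theorem exists_blocks (s : ℝ) (hs : 0 < s) (hs1 : s < 1) : ∃ L N : ℕ, 2 ≤ L ∧ 1 < N ∧
    ((2 ^ L : ℕ) : ℝ) ^ s ≤ N ∧ ∃ e : Fin N → List Bool,
      (∀ p, (e p).length = L ∧ wD (e p) = 0 ∧ 2 * wN (e p) + 3 ≤ 2 ^ L) ∧
      ∀ p q, p ≠ q → 2 ≤ |wT (e p) - wT (e q)| := by
  obtain ⟨m, hm, hq⟩ := numeric s hs hs1
  set K : ℕ := (2 ^ (2*m))^2 + 1 with hK
  have hK2 : 2 ≤ K := by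
    have : 0 < (2 ^ (2*m))^2 := by positivity
    omega
  obtain ⟨q, hq0, hq⟩ := hq K
  obtain ⟨S, hS, hS1, hS2⟩ := exists_concat m hm (2 ^ (2*m)) K rfl (by rw [hK]; push_cast; rfl) q
  rw [← hS] at hq
  have hN : 1 < S.card := by
    rw [hS]
    apply Nat.one_lt_pow (by omega)
    have := Nat.two_dvd_centralBinom_of_one_le hm
    have h2 := Nat.centralBinom_pos m
    have := Nat.le_of_dvd h2 this
    omega
  have hlen : ∀ u ∈ S, (List.replicate K false ++ (u ++ List.replicate K true)).length
      = 2*K + 2*m*q := by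
    intro u hu
    simp only [List.length_append, List.length_replicate, (hS1 u hu).1]; ring
  have hT : ∀ u ∈ S, wT (List.replicate K false ++ (u ++ List.replicate K true))
      = 2 ^ K * wG K u + (K * wN (List.replicate K true) + wT (List.replicate K true)) := by
    intro u hu
    rw [wT_append, (rep_false K).2.1, (rep_false K).2.2, wN_append, wT_append, (hS1 u hu).2]
    simp only [List.length_replicate, wG]; ring
  refine ⟨2*K + 2*m*q, S.card, by omega, hN, hq,
    fun p => List.replicate K false ++ (((S.equivFin.symm p) : List Bool) ++ List.replicate K true),
    ?_, ?_⟩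
  · intro p
    have hu := (S.equivFin.symm p).2
    set u : List Bool := (S.equivFin.symm p).1
    refine ⟨hlen u hu, ?_, ?_⟩
    · rw [wD_append, wD_append, (rep_false K).2.2, rep_true, (hS1 u hu).2]; ring
    · have h1 := wN_lt (u ++ List.replicate K true)
      have h2 := hlen u hu
      rw [List.length_append, List.length_replicate] at h2
      rw [wN_append, (rep_false K).1, ← h2, pow_add]
      have h3 : (2:ℤ)^2 ≤ 2 ^ K := pow_le_pow_right₀ (by norm_num) hK2
      have h4 : (0:ℤ) < 2 ^ (u ++ List.replicate K true).length := by positivity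
      nlinarith
  · intro p p' hpp
    have hu := (S.equivFin.symm p).2
    have hu' := (S.equivFin.symm p').2
    have hne : (S.equivFin.symm p : List Bool) ≠ S.equivFin.symm p' := by
      intro h
      exact hpp (S.equivFin.symm.injective (Subtype.ext h))
    dsimp only
    set u : List Bool := (S.equivFin.symm p).1
    set u' : List Bool := (S.equivFin.symm p').1
    rw [hT u hu, hT u' hu']
    have hG := (hS2 u hu u' hu').2 hne
    have : 1 ≤ |wG K u - wG K u'| := Int.one_le_abs (sub_ne_zero.2 hG)
    rw [add_sub_add_right_eq_sub, ← mul_sub, abs_mul, abs_of_pos (by positivity)]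
    have h3 : (2:ℤ)^1 ≤ 2 ^ K := pow_le_pow_right₀ (by norm_num) (by omega)
    nlinarith

/-- balanced blocks of a given length -/
def Blk (L : ℕ) : Type := {w : List Bool // w.length = L ∧ wD w = 0}

/-- abscissa digit of a block -/
def nd {L : ℕ} (w : Blk L) : Fin (2 ^ L) := ⟨(wN w.1).toNat, by
  have h1 := wN_lt w.1
  rw [w.2.1] at h1
  have h2 : (0:ℤ) < 2 ^ L := by positivity
  zify
  rw [Int.toNat_of_nonneg (wN_nonneg _)]
  exact h1⟩
/-- ordinate digit of a block -/
def td {L : ℕ} (w : Blk L) : Fin (2 ^ L) := ⟨(wT w.1).toNat, by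
  have h1 := wT_lt w.1
  rw [w.2.1] at h1
  zify
  rw [Int.toNat_of_nonneg (wT_nonneg _)]
  exact h1⟩
theorem nd_cast {L : ℕ} (w : Blk L) : ((nd w : ℕ) : ℤ) = wN w.1 :=
  Int.toNat_of_nonneg (wN_nonneg _)
theorem td_cast {L : ℕ} (w : Blk L) : ((td w : ℕ) : ℤ) = wT w.1 :=
  Int.toNat_of_nonneg (wT_nonneg _)

/-- complement of a block -/
def cpl {L : ℕ} (w : Blk L) : Blk L := ⟨w.1.map not, by simpa using w.2.1, by
  rw [wD_compl, w.2.2]; rfl⟩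

theorem td_cpl {L : ℕ} (w : Blk L) : td (cpl w) = td w := by
  apply Fin.ext
  show (wT (w.1.map not)).toNat = (wT w.1).toNat
  rw [wT_compl, w.2.2, add_zero]

theorem ofDigits_step {b : ℕ} (a : ℕ → Fin b) :
    Real.ofDigits a = (((a 0 : ℕ) : ℝ) + Real.ofDigits (fun i => a (i+1))) / b := by
  rw [Real.ofDigits_eq_sum_add_ofDigits a 1]
  simp [Real.ofDigitsTerm]
  ring

theorem tak_seq {L : ℕ} (hL : 2 ≤ L) (w : ℕ → Blk L) :
    takagi (Real.ofDigits fun i => nd (w i)) = Real.ofDigits fun i => td (w i) := by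
  have h : ∀ n : ℕ, ∀ w : ℕ → Blk L, |takagi (Real.ofDigits fun i => nd (w i))
      - Real.ofDigits fun i => td (w i)| ≤ (1/2:ℝ)^n := by
    intro n
    induction n with
    | zero =>
      intro w
      have h1 := tak_nonneg (Real.ofDigits fun i => nd (w i))
      have h2 := tak_le (Real.ofDigits fun i => nd (w i))
      have h3 := Real.ofDigits_nonneg fun i => td (w i)
      have h4 := Real.ofDigits_le_one fun i => td (w i)
      rw [pow_zero, abs_le]; constructor <;> linarith
    | succ n ih =>
      intro w
      have I := ih (fun i => w (i+1))
      rw [ofDigits_step (fun i => nd (w i)), ofDigits_step (fun i => td (w i))]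
      have hn : ((nd (w 0) : ℕ) : ℝ) = wN (w 0).1 := by exact_mod_cast nd_cast (w 0)
      have ht : ((td (w 0) : ℕ) : ℝ) = wT (w 0).1 := by exact_mod_cast td_cast (w 0)
      rw [hn, ht]
      have := tak_word (w 0).1 _ (Real.ofDigits_nonneg fun i => nd (w (i+1)))
        (Real.ofDigits_le_one fun i => nd (w (i+1)))
      rw [(w 0).2.1, (w 0).2.2] at this
      push_cast
      rw [this, ← sub_div]
      have e : (wT (w 0).1 : ℝ) + ((0:ℤ):ℝ) * Real.ofDigits (fun i => nd (w (i+1)))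
        + takagi (Real.ofDigits fun i => nd (w (i+1)))
        - (wT (w 0).1 + Real.ofDigits (fun i => td (w (i+1))))
        = takagi (Real.ofDigits fun i => nd (w (i+1))) - Real.ofDigits (fun i => td (w (i+1))) := by
        push_cast; ring
      rw [e, abs_div, abs_of_pos (show (0:ℝ) < 2 ^ L by positivity), pow_succ,
        div_le_iff₀ (by positivity)]
      have h2 : (2:ℝ)^1 ≤ 2 ^ L := pow_le_pow_right₀ (by norm_num) (by omega)
      have h3 : (0:ℝ) < (1/2)^n := by positivity
      nlinarith
  have ht := tendsto_pow_atTop_nhds_zero_of_lt_one (r := (1/2:ℝ)) (by norm_num) (by norm_num)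
  have := ge_of_tendsto' ht (fun n => h n w)
  exact sub_eq_zero.1 (abs_nonpos_iff.1 this)

theorem level_pos {L : ℕ} (hL : 2 ≤ L) (w : ℕ → Blk L)
    (hw : ∀ i, 2 * wN (w i).1 + 3 ≤ 2 ^ L) :
    0 < dimH (levelSet (Real.ofDigits fun i => td (w i))) := by
  have hb : 1 < 2 ^ L := Nat.one_lt_two_pow (by omega)
  have hLpos : (0:ℝ≥0) < 1 / (L:ℝ≥0) := by
    have : (0:ℝ≥0) < L := by exact_mod_cast (by omega : 0 < L)
    positivity
  have hd := dim_lower hb (N := 2) (by norm_num)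
    (fun i p => nd (if p = 0 then w i else cpl (w i))) (by
      intro i p q hpq
      rw [nd_cast, nd_cast]
      have h1 := wN_compl (w i).1
      rw [(w i).2.1] at h1
      have h2 := hw i
      have h3 : wN (cpl (w i)).1 = 2 ^ L - 1 - wN (w i).1 := h1
      fin_cases p <;> fin_cases q <;> simp [h3] at hpq ⊢
      · exact le_abs.2 (Or.inr (by linarith))
      · exact le_abs.2 (Or.inl (by linarith)))
    (1 / (L:ℝ≥0)) hLpos (by
      push_cast
      rw [one_div, Real.pow_rpow_inv_natCast (by norm_num) (by omega)])
  refine lt_of_lt_of_le (ENNReal.coe_pos.2 hLpos) (hd.trans (dimH_mono ?_))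
  rintro _ ⟨c, rfl⟩
  refine ⟨⟨Real.ofDigits_nonneg _, Real.ofDigits_le_one _⟩, ?_⟩
  dsimp only
  rw [tak_seq hL (fun i => if c i = 0 then w i else cpl (w i))]
  congr 1
  funext i
  split_ifs
  · rfl
  · exact td_cpl _

/-- The set of ordinates whose Takagi level set has positive Hausdorff dimension has
full Hausdorff dimension. -/
theorem dimH_ordinates_positive_dim_levelSets :
    dimH {y ∈ Set.Icc (0 : ℝ) (2 / 3) | 0 < dimH (levelSet y)} = 1 := by
  apply le_antisymm
  · exact (dimH_mono (Set.subset_univ _)).trans Real.dimH_univ.le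
  · apply le_of_forall_lt
    intro a ha
    obtain ⟨s, has, hs1⟩ := ENNReal.lt_iff_exists_nnreal_btwn.1 ha
    have hs0 : 0 < s := by
      exact ENNReal.coe_pos.1 (pos_of_gt has)
    have hs1' : s < 1 := by exact_mod_cast hs1
    refine lt_of_lt_of_le has ?_
    obtain ⟨L, N, hL, hN, hLN, e, he1, he2⟩ := exists_blocks s (by exact_mod_cast hs0)
      (by exact_mod_cast hs1')
    set f : Fin N → Blk L := fun p => ⟨e p, (he1 p).1, (he1 p).2.1⟩ with hf
    have hb : 1 < 2 ^ L := Nat.one_lt_two_pow (by omega)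
    refine (dim_lower hb hN (fun _ p => td (f p)) ?_ s hs0 hLN).trans (dimH_mono ?_)
    · intro i p q hpq
      rw [td_cast, td_cast]
      exact he2 p q hpq
    · rintro _ ⟨c, rfl⟩
      refine ⟨?_, level_pos hL (fun i => f (c i)) (fun i => (he1 (c i)).2.2)⟩
      dsimp only
      rw [← tak_seq hL (fun i => f (c i))]
      exact ⟨tak_nonneg _, tak_le _⟩
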